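/- Let K be a field of characteristic ≠ 2 with more than three elements, G = SL₂(K), and V a quadratic ℤ[G]-module. Let i = −I ∈ G be the central involution. Then C_V(G) = C_V(i), [G,V] = [i,V], and V = C_V(i) ⊕ [i,V]. -/

import Mathlib

/-!
STATEMENT 4: Let K be a field of characteristic ≠ 2 with more than three elements,
G = SL₂(K), and V a quadratic ℤ[G]-module.  Let i = −I ∈ G be the central involution.
Then C_V(G) = C_V(i), [G,V] = [i,V], and V = C_V(i) ⊕ [i,V].
-/

noncomputable section

abbrev SL2 (K : Type*) [Field K] := Matrix.SpecialLinearGroup (Fin 2) K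

/-- `u_λ = (1 λ; 0 1)`. -/
def uEl {K : Type*} [Field K] (lam : K) : SL2 K :=
  ⟨!![1, lam; 0, 1], by simp [Matrix.det_fin_two_of]⟩

/-- The central involution `−I`. -/
def iEl (K : Type*) [Field K] : SL2 K :=
  ⟨!![-1, 0; 0, -1], by simp [Matrix.det_fin_two_of]⟩

/-- The fixed points `C_V(S)` of a set `S` of group elements. -/
def fixV {K : Type*} (V : Type*) [Field K] [AddCommGroup V] [DistribMulAction (SL2 K) V]
    (S : Set (SL2 K)) : AddSubgroup V where
  carrier := {v | ∀ g ∈ S, g • v = v}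
  zero_mem' := by intro g _; simp
  add_mem' := by intro a b ha hb g hg; rw [smul_add, ha g hg, hb g hg]
  neg_mem' := by intro a ha g hg; rw [smul_neg, ha g hg]

/-- `[S,V]`, the subgroup of `V` generated by `{g·v − v : g ∈ S, v ∈ V}`. -/
def commV {K : Type*} (V : Type*) [Field K] [AddCommGroup V] [DistribMulAction (SL2 K) V]
    (S : Set (SL2 K)) : AddSubgroup V :=
  AddSubgroup.closure {w | ∃ g ∈ S, ∃ v : V, w = g • v - v}

/-- Weyl elements. -/
def wEl {K : Type*} [Field K] (a : K) (ha : a ≠ 0) : SL2 K :=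
  ⟨!![0, a; -a⁻¹, 0], by simp [Matrix.det_fin_two_of, ha]⟩

/-- Torus elements. -/
def tEl {K : Type*} [Field K] (a : K) (ha : a ≠ 0) : SL2 K :=
  ⟨!![a, 0; 0, a⁻¹], by simp [Matrix.det_fin_two_of, ha]⟩

/-- Lower unipotent elements. -/
def lEl {K : Type*} [Field K] (a : K) : SL2 K :=
  ⟨!![1, 0; a, 1], by simp [Matrix.det_fin_two_of]⟩

section rels
variable {K : Type*} [Field K]

theorem u_val (a : K) : (uEl a).1 = !![1, a; 0, 1] := rfl
theorem l_val (a : K) : (lEl a).1 = !![1, 0; a, 1] := rfl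
theorem w_val (a : K) (ha : a ≠ 0) : (wEl a ha).1 = !![0, a; -a⁻¹, 0] := rfl
theorem t_val (a : K) (ha : a ≠ 0) : (tEl a ha).1 = !![a, 0; 0, a⁻¹] := rfl
theorem i_val : (iEl K).1 = !![-1, 0; 0, -1] := rfl

theorem u_add (a b : K) : (uEl (a + b) : SL2 K) = uEl a * uEl b := by
  apply Subtype.ext
  simp [Matrix.SpecialLinearGroup.coe_mul, u_val, add_comm]

theorem w_sq (a : K) (ha : a ≠ 0) : wEl a ha * wEl a ha = iEl K := by
  apply Subtype.ext
  simp [Matrix.SpecialLinearGroup.coe_mul, w_val, i_val, ha]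

theorem i_comm (g : SL2 K) : iEl K * g = g * iEl K := by
  have h : ((iEl K : SL2 K) : Matrix (Fin 2) (Fin 2) K) = -1 := by
    ext i j; fin_cases i <;> fin_cases j <;> simp [iEl]
  apply Subtype.ext
  simp [h]

theorem i_sq : iEl K * iEl K = 1 := by
  apply Subtype.ext
  simp [Matrix.SpecialLinearGroup.coe_mul, i_val, Matrix.one_fin_two]

theorem uwu (a : K) (ha : a ≠ 0) :
    uEl a * wEl a ha * uEl a = wEl a ha * uEl (-a) * wEl a ha := by
  apply Subtype.ext
  simp [Matrix.SpecialLinearGroup.coe_mul, u_val, w_val, ha]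

theorem tu (a b : K) (ha : a ≠ 0) : tEl a ha * uEl b = uEl (a * a * b) * tEl a ha := by
  apply Subtype.ext
  simp [Matrix.SpecialLinearGroup.coe_mul, u_val, t_val]
  field_simp

theorem w_t (a b : K) (ha : a ≠ 0) (hb : b ≠ 0) (hab : b * a⁻¹ ≠ 0) :
    wEl b hb = wEl a ha * tEl ((b * a⁻¹)⁻¹) (inv_ne_zero hab) := by
  apply Subtype.ext
  simp [Matrix.SpecialLinearGroup.coe_mul, w_val, t_val]
  constructor <;> field_simp

theorem wu_l (a : K) : wEl 1 one_ne_zero * uEl a = lEl (-a) * wEl 1 one_ne_zero := by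
  apply Subtype.ext
  simp [Matrix.SpecialLinearGroup.coe_mul, w_val, u_val, l_val]

theorem gen (H : Subgroup (SL2 K)) (hu : ∀ a, uEl a ∈ H) (hl : ∀ a, lEl a ∈ H) (g : SL2 K) :
    g ∈ H := by
  have key : ∀ g : SL2 K, g.1 1 0 ≠ 0 → g ∈ H := by
    intro g hc
    have hd := g.2
    rw [Matrix.det_fin_two] at hd
    have : g = uEl ((g.1 0 0 - 1) / g.1 1 0) * lEl (g.1 1 0) * uEl ((g.1 1 1 - 1) / g.1 1 0) := by
      apply Subtype.ext
      rw [Matrix.eta_fin_two g.1] 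
      generalize g.1 0 0 = a at *
      generalize g.1 0 1 = b at *
      generalize g.1 1 0 = c at *
      generalize g.1 1 1 = d at *
      simp [Matrix.SpecialLinearGroup.coe_mul, u_val, l_val]
      field_simp
      refine ⟨⟨by ring, by linear_combination -hd⟩, by ring⟩
    rw [this]
    exact H.mul_mem (H.mul_mem (hu _) (hl _)) (hu _)
  by_cases hc : g.1 1 0 = 0
  · have h1 : g * lEl 1 ∈ H := by
      apply key
      have hd := g.2
      rw [Matrix.det_fin_two, hc] at hd
      have : (g * lEl 1).1 1 0 = g.1 1 0 + g.1 1 1 := by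
        simp [l_val, Matrix.SpecialLinearGroup.coe_mul, Matrix.mul_apply, Fin.sum_univ_two]
      rw [this, hc, zero_add]
      intro h
      rw [h] at hd
      simp at hd
    exact (H.mul_mem_cancel_right (hl 1)).1 h1
  · exact key g hc

end rels

section ringlevel
variable {K R : Type*} [Field K] [Ring R] (r : SL2 K →* R)

/-- `u_a - 1` in the ring. -/
def dEl (a : K) : R := r (uEl a) - 1

theorem r_u (a : K) : r (uEl a) = 1 + dEl r a := by simp [dEl]

variable (hq : ∀ a b : K, dEl r a * dEl r b = 0)
set_option linter.unusedSectionVars false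

theorem d_add (hq : ∀ a b : K, dEl r a * dEl r b = 0) (a b : K) :
    dEl r (a + b) = dEl r a + dEl r b := by
  have h := hq a b
  simp only [dEl] at *
  rw [u_add, map_mul]
  rw [← sub_eq_zero, ← h]
  noncomm_ring

theorem d_zero (hq : ∀ a b : K, dEl r a * dEl r b = 0) : dEl r (0 : K) = 0 := by
  have := d_add r hq 0 0
  simpa using this

theorem d_neg (hq : ∀ a b : K, dEl r a * dEl r b = 0) (a : K) : dEl r (-a) = - dEl r a := by
  have := d_add r hq a (-a)
  rw [add_neg_cancel, d_zero r hq] at this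
  exact eq_neg_of_add_eq_zero_right this.symm

theorem d_two (hq : ∀ a b : K, dEl r a * dEl r b = 0) (a : K) :
    dEl r (2 * a) = 2 * dEl r a := by
  rw [two_mul, d_add r hq, two_mul]

theorem t_d (a b : K) (ha : a ≠ 0) :
    r (tEl a ha) * dEl r b = dEl r (a * a * b) * r (tEl a ha) := by
  simp only [dEl, mul_sub, sub_mul, ← map_mul, tu, mul_one, one_mul]

theorem rel1 (hq : ∀ a b : K, dEl r a * dEl r b = 0) (a : K) (ha : a ≠ 0) :
    dEl r a * r (wEl a ha) + dEl r a * r (wEl a ha) * dEl r a =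
      dEl r a * r (iEl K) - dEl r a * r (wEl a ha) * dEl r a * r (wEl a ha) := by
  have h := congrArg r (uwu a ha)
  have hw := congrArg r (w_sq a ha)
  simp only [map_mul, r_u, d_neg r hq] at h hw
  have h2 := congrArg (fun x => dEl r a * x) h
  have hqa := hq a a
  rw [← hw]
  generalize dEl r a = D at *
  generalize r (wEl a ha) = W at *
  have e1 : D * ((1 + D) * W * (1 + D)) = D * W + D * W * D + D * D * (W + W * D) := by noncomm_ring
  have e2 : D * (W * (1 + -D) * W) = D * (W * W) - D * W * D * W := by noncomm_ring
  rw [e1, e2, hqa, zero_mul, add_zero] at h2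
  exact h2

/-- every quadratic representation with `i` acting trivially is trivial -/
theorem triv (h2 : (2 : K) ≠ 0) (hK : ∃ m : K, m ≠ 0 ∧ m * m ≠ 1)
    (hq : ∀ a b : K, dEl r a * dEl r b = 0) (hi : r (iEl K) = 1) (g : SL2 K) : r g = 1 := by
  have s1 : ∀ a (ha : a ≠ 0), dEl r (2 * a) * r (wEl a ha) = dEl r (2 * a) := by
    intro a ha
    have h := rel1 r hq a ha
    have hw := congrArg r (w_sq a ha)
    rw [map_mul, hi] at hw
    rw [hi] at h
    rw [d_two r hq]
    generalize dEl r a = D at *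
    generalize r (wEl a ha) = W at *
    have h' : D * W * D + D * W * D * W - D + D * W = 0 := by
      rw [mul_one] at h
      rw [← sub_eq_zero] at h
      rw [← h]
      abel
    have h'' := congrArg (fun x => x * (1 - W)) h'
    simp only [zero_mul] at h''
    have e : (D * W * D + D * W * D * W - D + D * W) * (1 - W) =
      D * W * D * (1 - W * W) - D * (1 - W * W) + (2 * D * W - 2 * D * (W * W)) := by
      noncomm_ring
    rw [e, hw] at h''
    simpa [sub_eq_zero] using h''
  -- w-conjugates
  have s2 : ∀ a b : K, dEl r a * r (wEl 1 one_ne_zero) * dEl r b = 0 := by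
    intro a b
    by_cases ha : a = 0
    · rw [ha, d_zero r hq]; simp
    have ha2 : a / 2 ≠ 0 := div_ne_zero ha h2
    have h := s1 (a / 2) ha2
    rw [mul_div_cancel₀ _ h2, w_t 1 (a / 2) one_ne_zero ha2 (by simpa using ha2), map_mul] at h
    set c := ((a / 2) * (1 : K)⁻¹)⁻¹ with hc
    have hc0 : c ≠ 0 := by rw [hc, inv_one, mul_one]; exact inv_ne_zero ha2
    have e : dEl r b = dEl r (c * c * ((c * c)⁻¹ * b)) := by
      congr 1; field_simp
    have h3 := congrArg (fun x => x * dEl r ((c * c)⁻¹ * b)) h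
    simp only [hq, mul_assoc, t_d] at h3
    have h4 : dEl r a * r (wEl 1 one_ne_zero) * dEl r b * r (tEl c hc0) = 0 := by
      rw [e]; simpa only [mul_assoc] using h3
    have h5 := congrArg (fun x => x * r ((tEl c hc0)⁻¹)) h4
    simpa only [mul_assoc, ← map_mul, mul_inv_cancel, map_one, mul_one, zero_mul] using h5
  have s3 : ∀ (g : SL2 K) (b : K), r g * dEl r b = dEl r b := by
    intro g b
    let H : Subgroup (SL2 K) :=
      { carrier := {g | ∀ b, r g * dEl r b = dEl r b}
        one_mem' := by intro b; simp
        mul_mem' := by intro x y hx hy b; rw [map_mul, mul_assoc, hy, hx]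
        inv_mem' := by
          intro x hx b
          have h := congrArg (fun z => r x⁻¹ * z) (hx b)
          simp only [← mul_assoc, ← map_mul, inv_mul_cancel, map_one, one_mul] at h
          exact h.symm }
    refine gen H ?_ ?_ g b
    · intro a b
      rw [r_u, add_mul, hq]; simp
    · intro a b
      have h1 := s2 (-a) b
      have hl : lEl a = iEl K * (wEl 1 one_ne_zero * uEl (-a) * wEl 1 one_ne_zero) := by
        rw [wu_l, mul_assoc, w_sq, neg_neg, ← i_comm, ← mul_assoc, i_sq, one_mul]
      rw [hl, map_mul, hi, one_mul, map_mul, map_mul, r_u]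
      have hw := congrArg r (w_sq (1 : K) one_ne_zero)
      rw [map_mul, hi] at hw
      generalize r (wEl 1 one_ne_zero) = W at *
      have e : W * (1 + dEl r (-a)) * W * dEl r b =
        (W * W) * dEl r b + W * (dEl r (-a) * W * dEl r b) := by noncomm_ring
      rw [e, h1, hw]; simp
  have s4 : ∀ g h : SL2 K, r h * (r g - 1) = r g - 1 := by
    intro g
    let H : Subgroup (SL2 K) :=
      { carrier := {g | ∀ h, r h * (r g - 1) = r g - 1}
        one_mem' := by intro b; simp
        mul_mem' := by
          intro x y hx hy h
          have e : r (x * y) - 1 = r x * (r y - 1) + (r x - 1) := by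
            rw [map_mul]; noncomm_ring
          rw [e, mul_add, hx h, ← mul_assoc, ← map_mul, hy, hy]
        inv_mem' := by
          intro x hx h
          have e : r x⁻¹ - 1 = - (r x⁻¹ * (r x - 1)) := by
            rw [mul_sub, ← map_mul]; simp
          rw [e, mul_neg, ← mul_assoc, ← map_mul, hx, hx] }
    refine gen H ?_ ?_ g
    · intro a h
      exact s3 h a
    · intro a h
      have hl : lEl a = wEl 1 one_ne_zero * uEl (-a) * (wEl 1 one_ne_zero)⁻¹ := by
        rw [wu_l]; simp
      have e : r (lEl a) - 1 = r (wEl 1 one_ne_zero) * dEl r (-a) * r (wEl 1 one_ne_zero)⁻¹ := by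
        rw [hl, dEl, mul_sub, sub_mul, map_mul, map_mul, mul_one, ← map_mul r _ (_)⁻¹]
        simp
      rw [e, s3, ← mul_assoc, s3]
  have s5 : ∀ a : K, dEl r a = 0 := by
    obtain ⟨m, hm, hm1⟩ := hK
    intro a
    have h1 : ∀ b : K, dEl r (m * m * b) = dEl r b := by
      intro b
      have h := t_d r m b hm
      rw [s3] at h
      have h4 := s4 (tEl m hm) (uEl (m * m * b))
      rw [r_u, add_mul, one_mul, add_eq_left, mul_sub, ← h, mul_one, sub_eq_zero] at h4
      exact h4.symm
    have hm2 : m * m - 1 ≠ 0 := sub_ne_zero.2 hm1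
    have h2 := h1 (a / (m * m - 1))
    have e : m * m * (a / (m * m - 1)) = a + a / (m * m - 1) := by 
      have : m * m * (a / (m * m - 1)) - a / (m * m - 1) = (m * m - 1) * (a / (m * m - 1)) := by ring
      rw [mul_div_cancel₀ _ hm2] at this
      exact eq_add_of_sub_eq this
    rw [e, d_add r hq, add_eq_right] at h2
    exact h2
  have : g ∈ r.ker := by
    refine gen _ ?_ ?_ g
    · intro a
      rw [MonoidHom.mem_ker, r_u, s5, add_zero]
    · intro a
      have hl : lEl a = wEl 1 one_ne_zero * uEl (-a) * (wEl 1 one_ne_zero)⁻¹ := by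
        rw [wu_l]; simp
      rw [MonoidHom.mem_ker, hl, map_mul, map_mul, r_u, s5, add_zero, mul_one, ← map_mul]
      simp
  exact this

theorem two_t (h2 : (2 : K) ≠ 0) (hq : ∀ a b : K, dEl r a * dEl r b = 0)
    (hi : ∀ a, dEl r a * r (iEl K) = - dEl r a) (m : K) :
    2 * (r (tEl (2 : K)⁻¹ (inv_ne_zero h2)) * dEl r m) = dEl r m := by
  have s1 : ∀ a (ha : a ≠ 0),
      2 * (dEl r a * r (wEl a ha) * dEl r a) = - (2 * dEl r a) := by
    intro a ha
    have h := rel1 r hq a ha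
    have hw := congrArg r (w_sq a ha)
    have hia := hi a
    rw [hia] at h
    rw [map_mul] at hw
    generalize dEl r a = D at *
    generalize r (wEl a ha) = W at *
    generalize r (iEl K) = I at *
    have h' : D * W * D + D + (D * W * D + D) * W = 0 := by
      rw [← sub_eq_zero] at h
      rw [← h, add_mul]
      abel
    have h'' := congrArg (fun x => x * (1 - W)) h'
    simp only [zero_mul] at h''
    have e : (D * W * D + D + (D * W * D + D) * W) * (1 - W) =
      D * W * D + D - D * W * (D * (W * W)) - D * (W * W) := by
      noncomm_ring
    rw [e, hw, hia] at h''
    rw [eq_neg_iff_add_eq_zero, ← h'']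
    noncomm_ring
  by_cases hm : m = 0
  · rw [hm, d_zero r hq]; simp
  obtain ⟨k, rfl⟩ : ∃ k : K, m = 2 * (2 * k) := ⟨m / 2 / 2, by field_simp⟩
  have hk : k ≠ 0 := by rintro rfl; simp at hm
  have h2k : 2 * k ≠ 0 := mul_ne_zero h2 hk
  have e0 : wEl (2 * k) h2k = wEl k hk * tEl (2 : K)⁻¹ (inv_ne_zero h2) := by
    apply Subtype.ext
    simp [Matrix.SpecialLinearGroup.coe_mul, w_val, t_val, mul_comm]
  set T := r (tEl (2 : K)⁻¹ (inv_ne_zero h2)) with hT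
  have e1 : T * dEl r (2 * (2 * k)) = dEl r k * T := by
    rw [hT, t_d]; congr 2; field_simp
  have e2 : T * dEl r (2 * k) * 2 = dEl r k * T := by
    rw [← e1, d_two r hq (2 * k), mul_assoc, mul_two, two_mul (dEl r (2 * k))]
  have a1 := s1 (2 * k) h2k
  have a2 := s1 k hk
  rw [e0, map_mul, ← hT] at a1
  rw [e1]
  have e3 : 2 * (dEl r (2 * k) * (r (wEl k hk) * T) * dEl r (2 * k)) =
      2 * (dEl r k * r (wEl k hk) * dEl r k) * T := by
    rw [mul_assoc (2 : R), mul_assoc _ (dEl r k) T, ← e2, d_two r hq k]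
    noncomm_ring
  rw [e3, a2] at a1
  rw [d_two r hq (2 * k)]
  rw [neg_mul, neg_inj, mul_assoc] at a1
  exact a1

end ringlevel

/-- restriction of the action to the fixed points of `i` -/
def resRep (K V : Type*) [Field K] [AddCommGroup V] [DistribMulAction (SL2 K) V] :
    SL2 K →* AddMonoid.End (fixV V ({iEl K} : Set (SL2 K))) where
  toFun g := AddMonoidHom.mk' (fun v => ⟨g • v.1, by
    rintro _ rfl
    rw [← mul_smul, i_comm, mul_smul, v.2 _ rfl]⟩) (by
      intro a b; apply Subtype.ext; simp)
  map_one' := by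
    ext v
    exact one_smul (SL2 K) v.1
  map_mul' g h := by
    ext v
    exact mul_smul g h v.1

theorem exists_m {K : Type*} [Field K] (hcard : 3 < Cardinal.mk K) :
    ∃ m : K, m ≠ 0 ∧ m * m ≠ 1 := by
  classical
  by_contra! h
  have : (Set.univ : Set K) ⊆ (({0, 1, -1} : Finset K) : Set K) := by
    intro x _
    by_cases hx : x = 0
    · simp [hx]
    · have := mul_self_eq_one_iff.1 (h x hx)
      simp [this]
  have h1 := Cardinal.mk_le_mk_of_subset this
  rw [Cardinal.mk_univ] at h1
  have h3 : Cardinal.mk (({0, 1, -1} : Finset K) : Set K) = (({0, 1, -1} : Finset K).card : Cardinal) :=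
    Cardinal.mk_coe_finset
  rw [h3] at h1
  have h2 : (({0, 1, -1} : Finset K).card : Cardinal) ≤ 3 := by
    exact_mod_cast Finset.card_le_three
  exact absurd hcard (not_lt.2 (h1.trans h2))

theorem stmt4 (K V : Type*) [Field K]
    (hchar : ringChar K ≠ 2) (hcard : 3 < Cardinal.mk K)
    [AddCommGroup V] [DistribMulAction (SL2 K) V]
    (hquad : ∀ (lam mu : K) (v : V), uEl lam • (uEl mu • v - v) = uEl mu • v - v) :
    fixV V (Set.univ : Set (SL2 K)) = fixV V ({iEl K} : Set (SL2 K)) ∧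
    commV V (Set.univ : Set (SL2 K)) = commV V ({iEl K} : Set (SL2 K)) ∧
    IsCompl (fixV V ({iEl K} : Set (SL2 K))) (commV V ({iEl K} : Set (SL2 K))) := by
  classical
  have h2 : (2 : K) ≠ 0 := Ring.two_ne_zero hchar
  have hK := exists_m hcard
  -- fixed points
  have hfix : ∀ v : V, iEl K • v = v → ∀ g : SL2 K, g • v = v := by
    intro v hv g
    have := triv (resRep K V) h2 hK (by
      intro a b
      ext ⟨x, hx⟩
      have := hquad a b x
      rw [← sub_eq_zero] at this
      exact this) (by
      ext ⟨x, hx⟩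
      exact hx _ rfl) g
    have h3 := congrArg Subtype.val (DFunLike.congr_fun this ⟨v, by rintro _ rfl; exact hv⟩)
    exact h3
  set I := iEl K with hI
  have hII : ∀ v : V, I • I • v = v := by intro v; rw [← mul_smul, i_sq, one_smul]
  have hIg : ∀ (g : SL2 K) (v : V), I • g • v = g • I • v := by
    intro g v; rw [← mul_smul, i_comm, mul_smul]
  have hplus : ∀ (v : V) (g : SL2 K), g • (v + I • v) = v + I • v := by
    intro v g
    apply hfix
    rw [smul_add, hII, add_comm]
  have hminus : ∀ (g : SL2 K) (v : V), I • (g • v - v) = -(g • v - v) := by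
    intro g v
    have := hplus v g
    rw [smul_add] at this
    rw [smul_sub, hIg, eq_sub_of_add_eq' this]
    abel
  -- the torus element
  set T := tEl (2 : K)⁻¹ (inv_ne_zero h2) with hT
  have hTd : ∀ (a : K) (v : V), T • (uEl a • v - v) + T • (uEl a • v - v) = uEl a • v - v := by
    intro a v
    have := two_t (DistribMulAction.toAddMonoidEnd (SL2 K) V) h2 (by
      intro a b
      ext x
      have := hquad a b x
      rw [← sub_eq_zero] at this
      exact this) (by
      intro a
      ext x
      have := hminus (uEl a) x
      rw [smul_sub, hIg] at this
      change uEl a • I • x - I • x = -(uEl a • x - x)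
      exact this) a
    have h3 := DFunLike.congr_fun this v
    rw [two_mul] at h3
    exact h3
  -- D = [U,V]
  set D : AddSubgroup V := AddSubgroup.closure {w | ∃ (a : K) (v : V), w = uEl a • v - v} with hD
  have hDmem : ∀ (a : K) (v : V), uEl a • v - v ∈ D := fun a v =>
    AddSubgroup.subset_closure ⟨a, v, rfl⟩
  have hDu : ∀ y ∈ D, ∀ a : K, uEl a • y = y := by
    intro y hy a
    induction hy using AddSubgroup.closure_induction with
    | mem x hx => obtain ⟨b, v, rfl⟩ := hx; exact hquad a b v
    | zero => simp
    | add x y _ _ hx hy => rw [smul_add, hx, hy]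
    | neg x _ hx => rw [smul_neg, hx]
  have hDT : ∀ y ∈ D, T • y + T • y = y := by
    intro y hy
    induction hy using AddSubgroup.closure_induction with
    | mem x hx => obtain ⟨b, v, rfl⟩ := hx; exact hTd b v
    | zero => simp
    | add x y _ _ hx hy =>
      rw [smul_add]
      nth_rewrite 3 [← hx]
      nth_rewrite 3 [← hy]
      abel
    | neg x _ hx =>
      rw [smul_neg]
      nth_rewrite 3 [← hx]
      abel
  have hDI : ∀ y ∈ D, I • y = -y := by
    intro y hy
    induction hy using AddSubgroup.closure_induction with
    | mem x hx => obtain ⟨b, v, rfl⟩ := hx; exact hminus _ v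
    | zero => simp
    | add x y _ _ hx hy => rw [smul_add, hx, hy]; abel
    | neg x _ hx => rw [smul_neg, hx]
  set w : SL2 K := wEl 1 one_ne_zero with hw
  have hww : w * w = I := w_sq 1 one_ne_zero
  have hDfix : ∀ y ∈ D, (∀ a : K, uEl a • w • y = w • y) → y = 0 := by
    intro y hy h
    have hall : ∀ g : SL2 K, g • y = y := by
      intro g
      have : g ∈ MulAction.stabilizer (SL2 K) y := by
        refine gen _ ?_ ?_ g
        · intro a; exact hDu y hy a
        · intro a
          have hl : lEl a = I * (w * uEl (-a) * w) := by
            rw [hw, wu_l, mul_assoc, w_sq, neg_neg, ← i_comm, ← mul_assoc, i_sq, one_mul]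
          rw [MulAction.mem_stabilizer_iff, hl, mul_smul, mul_smul, mul_smul, h, ← mul_smul w w,
            hww, hII]
      exact this
    have := hDT y hy
    rw [hall] at this
    simpa using this
  -- [G,V] is D + wD
  have hGV : ∀ (g : SL2 K) (v : V), ∃ y ∈ D, ∃ z ∈ D, g • v - v = y + w • z := by
    intro g
    let H : Subgroup (SL2 K) :=
      { carrier := {g | (∀ v : V, ∃ y ∈ D, ∃ z ∈ D, g • v - v = y + w • z)}
        one_mem' := fun v => ⟨0, D.zero_mem, 0, D.zero_mem, by simp⟩
        mul_mem' := by
          intro g h hg hh v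
          obtain ⟨y, hy, z, hz, e⟩ := hg (h • v)
          obtain ⟨y', hy', z', hz', e'⟩ := hh v
          refine ⟨y + y', D.add_mem hy hy', z + z', D.add_mem hz hz', ?_⟩
          have : (g * h) • v - v = (g • h • v - h • v) + (h • v - v) := by
            rw [mul_smul]; abel
          rw [this, e, e', smul_add]; abel
        inv_mem' := by
          intro g hg v
          obtain ⟨y, hy, z, hz, e⟩ := hg (g⁻¹ • v)
          refine ⟨-y, D.neg_mem hy, -z, D.neg_mem hz, ?_⟩
          rw [smul_inv_smul] at e
          rw [← neg_sub, e, smul_neg]; abel }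
    refine gen H ?_ ?_ g
    · intro a v
      exact ⟨_, hDmem a v, 0, D.zero_mem, by simp⟩
    · intro a v
      refine ⟨0, D.zero_mem, _, hDmem (-a) (w⁻¹ • v), ?_⟩
      have hl : lEl a = w * uEl (-a) * w⁻¹ := by
        rw [hw, wu_l]; simp
      rw [hl, zero_add, smul_sub, smul_inv_smul, mul_smul, mul_smul]
  -- a fixed commutator vanishes
  have hzero : ∀ (x : V), (∀ g : SL2 K, g • x = x) → (∃ y ∈ D, ∃ z ∈ D, x = y + w • z) → x = 0 := by
    rintro x hx ⟨y, hy, z, hz, rfl⟩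
    have hz0 : z = 0 := by
      apply hDfix z hz
      intro a
      have := hx (uEl a)
      rw [smul_add, hDu y hy, add_right_inj] at this
      exact this
    subst hz0
    simp only [smul_zero, add_zero] at hx ⊢
    apply hDfix y hy
    intro a
    rw [hx w, hx]
  -- elements of D + wD are in (I-1)(D + wD)
  have hdiv : ∀ y ∈ D, ∀ z ∈ D, ∃ q : V, I • q - q = y + w • z ∧ ∃ g : V, q = I • g - g := by
    have hTdiv : ∀ y ∈ D, ∃ q : V, I • q - q = y ∧ I • q = - q := by
      intro y hy
      have hTI : I • T • y = - (T • y) := by rw [hIg, hDI y hy, smul_neg]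
      refine ⟨-(T • y), ?_, ?_⟩
      · rw [smul_neg, hTI]
        nth_rewrite 3 [← hDT y hy]
        abel
      · rw [smul_neg, hTI]
    have hTdiv2 : ∀ y ∈ D, ∃ q : V, I • q - q = y ∧ ∃ g : V, q = I • g - g := by
      intro y hy
      have hTI : I • T • y = - (T • y) := by rw [hIg, hDI y hy, smul_neg]
      have hTTI : I • T • T • y = - (T • T • y) := by rw [hIg, hTI, smul_neg]
      refine ⟨-(T • y), ?_, T • T • y, ?_⟩
      · rw [smul_neg, hTI]
        nth_rewrite 3 [← hDT y hy]
        abel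
      · rw [hTTI]
        nth_rewrite 1 [← hDT y hy]
        rw [smul_add]
        abel
    intro y hy z hz
    obtain ⟨q, e, g, rfl⟩ := hTdiv2 y hy
    obtain ⟨q', e', g', rfl⟩ := hTdiv2 z hz
    refine ⟨(I • g - g) + w • (I • g' - g'), ?_, g + w • g', ?_⟩
    · rw [← e, ← e']
      simp only [smul_add, smul_sub, hIg w]
      abel
    · simp only [smul_add, smul_sub, hIg w]
      abel
  have hcI : ∀ x : V, x ∈ commV V ({I} : Set (SL2 K)) ↔ ∃ v : V, x = I • v - v := by
    intro x
    constructor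
    · intro hx
      induction hx using AddSubgroup.closure_induction with
      | mem x hx => obtain ⟨b, rfl, v, rfl⟩ := hx; exact ⟨v, rfl⟩
      | zero => exact ⟨0, by simp⟩
      | add x y _ _ hx hy =>
        obtain ⟨v, rfl⟩ := hx
        obtain ⟨v', rfl⟩ := hy
        exact ⟨v + v', by rw [smul_add]; abel⟩
      | neg x _ hx =>
        obtain ⟨v, rfl⟩ := hx
        exact ⟨-v, by rw [smul_neg]; abel⟩
    · rintro ⟨v, rfl⟩
      exact AddSubgroup.subset_closure ⟨I, rfl, v, rfl⟩
  refine ⟨?_, ?_, ?_⟩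
  · apply le_antisymm
    · intro v hv g _
      exact hv g (Set.mem_univ g)
    · intro v hv g _
      exact hfix v (hv I rfl) g
  · apply le_antisymm
    · refine (AddSubgroup.closure_le _).2 ?_
      rintro _ ⟨g, -, v, rfl⟩
      obtain ⟨y, hy, z, hz, e⟩ := hGV g v
      obtain ⟨q, e', -⟩ := hdiv y hy z hz
      exact (hcI _).2 ⟨q, by rw [e, e']⟩
    · apply AddSubgroup.closure_mono
      rintro _ ⟨g, -, v, rfl⟩
      exact ⟨g, Set.mem_univ g, v, rfl⟩
  · constructor
    · rw [AddSubgroup.disjoint_def]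
      intro x hx hx'
      obtain ⟨v, rfl⟩ := (hcI x).1 hx'
      exact hzero _ (hfix _ (hx I rfl)) (hGV I v)
    · rw [codisjoint_iff, eq_top_iff]
      intro v _
      obtain ⟨y, hy, z, hz, e⟩ := hGV I v
      obtain ⟨q, e', hq⟩ := hdiv y hy z hz
      rw [AddSubgroup.mem_sup]
      refine ⟨v - q, ?_, q, (hcI q).2 hq, by abel⟩
      rintro _ rfl
      have h5 : I • v - v = I • q - q := by rw [e, e']
      have h6 : I • v = I • q - q + v := by rw [← h5]; abel
      rw [smul_sub, h6]
      abel
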